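/- For all t > 0 and all ξ ∈ 𝕋 one has θ_t(ξ) ≤ θ_{t/8}(0) · exp(-πt|ξ|²/2) ≤ (1 + 3t^{-1/2}) · exp(-πt|ξ|²/2). -/

import Mathlib

open scoped ENNReal Real BigOperators
open Real

/-- The one-dimensional Theta function `θ_t(ζ) = Σ_{k∈ℤ} exp(-π(k-ζ)²t)`. -/
noncomputable def theta (t ζ : ℝ) : ℝ :=
  ∑' k : ℤ, Real.exp (-π * ((k : ℝ) - ζ) ^ 2 * t)

/-- The d-dimensional Theta function `Θ_t(ξ) = Π_j θ_t(ξ_j)`. -/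
noncomputable def bigTheta (d : ℕ) (t : ℝ) (ξ : Fin d → ℝ) : ℝ :=
  ∏ j, theta t (ξ j)

/-- The discrete normalized Gaussian kernel `g_t(n) = Θ_{1/t}(0)⁻¹ exp(-π|n|²/t)`. -/
noncomputable def gauss (d : ℕ) (t : ℝ) (n : Fin d → ℤ) : ℝ :=
  (bigTheta d (1 / t) 0)⁻¹ * Real.exp (-π * (∑ j, ((n j : ℝ)) ^ 2) / t)

/-- The convolution operator `G_t f(x) = Σ_n g_t(n) f(x-n)` on ℤ^d. -/
noncomputable def gConv (d : ℕ) (t : ℝ) (f : (Fin d → ℤ) → ℂ) (x : Fin d → ℤ) : ℂ :=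
  ∑' n : Fin d → ℤ, (gauss d t n : ℂ) * f (x - n)

/-- The ℓ^p norm (valued in ℝ≥0∞) of an ℝ≥0∞-valued function on ℤ^d. -/
noncomputable def lpNorm (d : ℕ) (p : ℝ) (F : (Fin d → ℤ) → ℝ≥0∞) : ℝ≥0∞ :=
  (∑' x : Fin d → ℤ, F x ^ p) ^ (1 / p)

lemma theta_nat_sum (s : ℝ) (hs : 0 < s) (n : ℕ) :
    ∑ i ∈ Finset.range n, Real.exp (-π * ((i : ℝ) + 1) ^ 2 * s) ≤ s ^ (-(1/2) : ℝ) / 2 := by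
  have hb : 0 < π * s := by positivity
  have hanti : AntitoneOn (fun x : ℝ => Real.exp (-(π * s) * x ^ 2)) (Set.Icc 0 (0 + (n : ℝ))) := by
    intro x hx y hy hxy
    apply Real.exp_le_exp.2
    have : x ^ 2 ≤ y ^ 2 := by
      have := hx.1
      gcongr
    nlinarith
  have h1 := hanti.sum_le_integral
  have h2 := integral_gaussian_Ioi (π * s)
  have h3 : ∫ x in (0:ℝ)..(0 + (n : ℝ)), Real.exp (-(π * s) * x ^ 2) ≤
      ∫ x in Set.Ioi (0:ℝ), Real.exp (-(π * s) * x ^ 2) := by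
    rw [intervalIntegral.integral_of_le (by simp)]
    apply MeasureTheory.setIntegral_mono_set (integrable_exp_neg_mul_sq hb).integrableOn
    · exact Filter.Eventually.of_forall fun x => (Real.exp_pos _).le
    · exact (Set.Ioc_subset_Ioi_self).eventuallyLE
  have h4 : √(π / (π * s)) = s ^ (-(1/2) : ℝ) := by
    rw [Real.rpow_neg hs.le, ← Real.sqrt_eq_rpow, ← Real.sqrt_inv]
    congr 1
    field_simp
  rw [h2, h4] at h3
  refine le_trans (le_of_eq ?_) (h1.trans h3)
  apply Finset.sum_congr rfl
  intro i _
  congr 1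
  push_cast
  ring

lemma theta_zero (s : ℝ) (hs : 0 < s) :
    Summable (fun k : ℤ => Real.exp (-π * ((k : ℝ) - 0) ^ 2 * s)) ∧
      theta s 0 ≤ 1 + s ^ (-(1/2) : ℝ) := by
  have hsum : Summable (fun i : ℕ => Real.exp (-π * ((i : ℝ) + 1) ^ 2 * s)) :=
    summable_of_sum_range_le (fun _ => (Real.exp_pos _).le) (theta_nat_sum s hs)
  have hle : ∑' i : ℕ, Real.exp (-π * ((i : ℝ) + 1) ^ 2 * s) ≤ s ^ (-(1/2) : ℝ) / 2 :=
    Real.tsum_le_of_sum_range_le (fun _ => (Real.exp_pos _).le) (theta_nat_sum s hs)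
  have e1 : (fun n : ℕ => Real.exp (-π * ((((n : ℤ) + 1 : ℤ) : ℝ) - 0) ^ 2 * s)) =
      fun i : ℕ => Real.exp (-π * ((i : ℝ) + 1) ^ 2 * s) := by
    funext n; push_cast; congr 1; ring
  have e2 : (fun n : ℕ => Real.exp (-π * (((-((n : ℤ) + 1) : ℤ) : ℝ) - 0) ^ 2 * s)) =
      fun i : ℕ => Real.exp (-π * ((i : ℝ) + 1) ^ 2 * s) := by
    funext n; push_cast; congr 1; ring
  have H := HasSum.of_add_one_of_neg_add_one
    (f := fun k : ℤ => Real.exp (-π * ((k : ℝ) - 0) ^ 2 * s))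
    (by rw [e1]; exact hsum.hasSum) (by rw [e2]; exact hsum.hasSum)
  refine ⟨H.summable, ?_⟩
  rw [theta, H.tsum_eq]
  simp only [Int.cast_zero, sub_self]
  norm_num at hle ⊢
  linarith

lemma theta_quad (k : ℤ) (ξ : ℝ) (hξ : ξ ∈ Set.Ico (-(1/2) : ℝ) (1/2)) :
    (k : ℝ) ^ 2 / 8 + ξ ^ 2 / 2 ≤ ((k : ℝ) - ξ) ^ 2 := by
  obtain ⟨h1, h2⟩ := hξ
  rcases lt_trichotomy k 0 with h | h | h
  · have : (k : ℝ) ≤ -1 := by exact_mod_cast (by omega : k ≤ -1)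
    nlinarith
  · subst h
    simp
    nlinarith [sq_nonneg ξ]
  · have : (1 : ℝ) ≤ k := by exact_mod_cast h
    nlinarith

/-- For all `t > 0` and `ξ ∈ 𝕋`:
`θ_t(ξ) ≤ θ_{t/8}(0) exp(-πt|ξ|²/2) ≤ (1 + 3t^{-1/2}) exp(-πt|ξ|²/2)`. -/
theorem theta_decay (t : ℝ) (ht : 0 < t) (ξ : ℝ) (hξ : ξ ∈ Set.Ico (-(1/2) : ℝ) (1/2)) :
    theta t ξ ≤ theta (t / 8) 0 * Real.exp (-π * t * ξ ^ 2 / 2) ∧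
      theta (t / 8) 0 * Real.exp (-π * t * ξ ^ 2 / 2) ≤
        (1 + 3 * t ^ (-(1/2) : ℝ)) * Real.exp (-π * t * ξ ^ 2 / 2) := by
  obtain ⟨hS, hT⟩ := theta_zero (t / 8) (by positivity)
  constructor
  · have hle : ∀ k : ℤ, Real.exp (-π * ((k : ℝ) - ξ) ^ 2 * t) ≤
        Real.exp (-π * ((k : ℝ) - 0) ^ 2 * (t / 8)) * Real.exp (-π * t * ξ ^ 2 / 2) := by
      intro k
      rw [← Real.exp_add]
      apply Real.exp_le_exp.2
      have := mul_le_mul_of_nonneg_left (theta_quad k ξ hξ) (by positivity : 0 ≤ π * t)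
      linarith
    have hS2 := hS.mul_right (Real.exp (-π * t * ξ ^ 2 / 2))
    rw [theta, theta, ← tsum_mul_right]
    exact (Summable.of_nonneg_of_le (fun _ => (Real.exp_pos _).le) hle hS2).tsum_le_tsum hle hS2
  · apply mul_le_mul_of_nonneg_right _ (Real.exp_pos _).le
    refine hT.trans ?_
    have h8 : (t / 8) ^ (-(1/2) : ℝ) = √8 * t ^ (-(1/2) : ℝ) := by
      rw [Real.div_rpow ht.le (by norm_num), Real.rpow_neg (by norm_num : (0:ℝ) ≤ 8),
        ← Real.sqrt_eq_rpow, div_inv_eq_mul, mul_comm]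
    have h9 : √8 ≤ 3 := by
      rw [Real.sqrt_le_left (by norm_num)]; norm_num
    rw [h8]
    gcongr
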